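/- Let g = (g^(L), …, g^(0)) be a tuple with g^(i) ∈ GL_{n_i}(ℝ) and g^(L) = I_{n_L}, and let U be a weight-space element. Then for all L ≥ s > 0, L > t ≥ 0, and every row vector Ψ ∈ ℝ^{1 × n_L}, one has [gb]^(s) · Ψ · [gW]^(L,t) = g^(s) · (b^(s) · Ψ · [W]^(L,t)) · (g^(t))^{−1} in ℝ^{n_s × n_t}, where [gW]^(L,t) := [gW]^(L) · [gW]^(L−1) · ⋯ · [gW]^(t+1). -/

import Mathlib

open Matrix

noncomputable section

/-- The product `[W]^(s,t) = W^(s) * W^(s-1) * ⋯ * W^(t+1)` of `s - t` weight matrices. -/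
def Wprod (n : ℕ → ℕ) (W : ∀ i : ℕ, Matrix (Fin (n i)) (Fin (n (i - 1))) ℝ) :
    (s : ℕ) → (t : ℕ) → Matrix (Fin (n s)) (Fin (n t)) ℝ
  | s, t =>
    if _h : t < s then W s * Wprod n W (s - 1) t
    else Matrix.of fun i j => if (i : ℕ) = (j : ℕ) then (1 : ℝ) else 0
termination_by s t => s
decreasing_by omega

/-- The action of `g` on the weights: `[gW]^(i) = g^(i) · W^(i) · (g^(i-1))⁻¹`. -/
def actW (n : ℕ → ℕ) (g : ∀ i : ℕ, GL (Fin (n i)) ℝ)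
    (W : ∀ i : ℕ, Matrix (Fin (n i)) (Fin (n (i - 1))) ℝ) (i : ℕ) :
    Matrix (Fin (n i)) (Fin (n (i - 1))) ℝ :=
  (g i : Matrix (Fin (n i)) (Fin (n i)) ℝ) * W i *
    (((g (i - 1))⁻¹ : GL (Fin (n (i - 1))) ℝ) : Matrix (Fin (n (i - 1))) (Fin (n (i - 1))) ℝ)

/-- The action of `g` on the biases: `[gb]^(i) = g^(i) · b^(i)`. -/
def actb (n : ℕ → ℕ) (g : ∀ i : ℕ, GL (Fin (n i)) ℝ)
    (b : ∀ i : ℕ, Matrix (Fin (n i)) (Fin 1) ℝ) (i : ℕ) : Matrix (Fin (n i)) (Fin 1) ℝ :=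
  (g i : Matrix (Fin (n i)) (Fin (n i)) ℝ) * b i

theorem Wprod_self (n : ℕ → ℕ) (W : ∀ i : ℕ, Matrix (Fin (n i)) (Fin (n (i - 1))) ℝ) (t : ℕ) :
    Wprod n W t t = 1 := by
  rw [Wprod, dif_neg (lt_irrefl t)]
  ext i j
  simp [Matrix.one_apply, Fin.ext_iff]

theorem Wprod_of_lt (n : ℕ → ℕ) (W : ∀ i : ℕ, Matrix (Fin (n i)) (Fin (n (i - 1))) ℝ) {s t : ℕ}
    (h : t < s) : Wprod n W s t = W s * Wprod n W (s - 1) t := by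
  rw [Wprod, dif_pos h]

theorem Wprod_actW (n : ℕ → ℕ) (g : ∀ i : ℕ, GL (Fin (n i)) ℝ)
    (W : ∀ i : ℕ, Matrix (Fin (n i)) (Fin (n (i - 1))) ℝ) {s t : ℕ} (h : t ≤ s) :
    Wprod n (actW n g W) s t =
      (g s : Matrix (Fin (n s)) (Fin (n s)) ℝ) * Wprod n W s t *
        (((g t)⁻¹ : GL (Fin (n t)) ℝ) : Matrix (Fin (n t)) (Fin (n t)) ℝ) := by
  induction s using Nat.strong_induction_on with
  | _ s ih =>
    obtain rfl | hlt := h.eq_or_lt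
    · rw [Wprod_self, Wprod_self, Matrix.mul_one, Units.mul_inv]
    · have hcancel (M : Matrix (Fin (n (s - 1))) (Fin (n t)) ℝ) :
          (((g (s - 1))⁻¹ : GL (Fin (n (s - 1))) ℝ) :
              Matrix (Fin (n (s - 1))) (Fin (n (s - 1))) ℝ) *
            ((g (s - 1) : Matrix (Fin (n (s - 1))) (Fin (n (s - 1))) ℝ) * M) = M := by
        rw [← Matrix.mul_assoc, Units.inv_mul, Matrix.one_mul]
      rw [Wprod_of_lt n _ hlt, Wprod_of_lt n _ hlt, ih (s - 1) (by omega) (by omega)]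
      simp only [actW, Matrix.mul_assoc, hcancel]

/-- if `g^(L) = I`, then for all `L ≥ s > 0`, `L > t ≥ 0` and every row vector
`Ψ ∈ ℝ^{1 × n_L}`, one has `[gb]^(s) · Ψ · [gW]^(L,t) = g^(s) · (b^(s) · Ψ · [W]^(L,t)) · (g^(t))⁻¹`. -/
theorem bW_act (L : ℕ) (hL : 1 ≤ L) (n : ℕ → ℕ) (hn : ∀ i, 1 ≤ n i)
    (g : ∀ i : ℕ, GL (Fin (n i)) ℝ)
    (hgL : (g L : Matrix (Fin (n L)) (Fin (n L)) ℝ) = 1)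
    (W : ∀ i : ℕ, Matrix (Fin (n i)) (Fin (n (i - 1))) ℝ)
    (b : ∀ i : ℕ, Matrix (Fin (n i)) (Fin 1) ℝ)
    (s t : ℕ) (hs : 0 < s) (hsL : s ≤ L) (htL : t < L)
    (Ψ : Matrix (Fin 1) (Fin (n L)) ℝ) :
    actb n g b s * Ψ * Wprod n (actW n g W) L t =
      (g s : Matrix (Fin (n s)) (Fin (n s)) ℝ) * (b s * Ψ * Wprod n W L t) *
        (((g t)⁻¹ : GL (Fin (n t)) ℝ) : Matrix (Fin (n t)) (Fin (n t)) ℝ) := by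
  rw [Wprod_actW n g W htL.le, hgL, Matrix.one_mul, actb]
  simp only [Matrix.mul_assoc]
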